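/- For Im τ > 0 and z in the strip {α + βτ : α,β ∈ ℝ, |β| < 1/2}, the function SD(z,τ) := (1/2) Σ_{n=0}^∞ (−1)^n sin((2n+1)πz) / cos((n+1/2)πτ) satisfies SD(z+1,τ) = −SD(z,τ), and its square extends to the elliptic function: SD(z,τ)² = ℘̃*(z,τ), where ℘̃*(z,τ) = −(1/16π²) ℘̃_τ(z) and ℘̃_τ is the translated Weierstrass function of the lattice ℤ + τℤ. -/

import Mathlib

open Complex
open scoped Real

/-- The Weierstrass ℘-function of the lattice `ℤ + τℤ`. -/
noncomputable def wp (τ : ℂ) (z : ℂ) : ℂ :=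
  1 / z ^ 2 + ∑' p : ℤ × ℤ,
    if p = 0 then 0 else
      (1 / (z + (p.1 : ℂ) + (p.2 : ℂ) * τ) ^ 2 - 1 / ((p.1 : ℂ) + (p.2 : ℂ) * τ) ^ 2)

/-- The translated Weierstrass function `℘̃_τ(z) = ℘_τ(z + (1+τ)/2) − ℘_τ((1+τ)/2)`. -/
noncomputable def wpTilde (τ : ℂ) (z : ℂ) : ℂ :=
  wp τ (z + (1 + τ) / 2) - wp τ ((1 + τ) / 2)

/-- The renormalized Jacobi function `SD(z,τ)`. -/
noncomputable def SD (τ : ℂ) (z : ℂ) : ℂ :=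
  (1 / 2) * ∑' n : ℕ, (-1 : ℂ) ^ n * Complex.sin ((2 * (n : ℂ) + 1) * (π : ℂ) * z) /
    Complex.cos (((n : ℂ) + 1/2) * (π : ℂ) * τ)

/-- The Weierstrass series of `ℤ + τℤ`, with the junk value `1 / 0 = 0` at the origin. -/
lemma hasSum_wp {τ : ℂ} (hτ : 0 < τ.im) (z : ℂ) :
    HasSum (fun p : ℤ × ℤ ↦ 1 / (z + (p.1 : ℂ) + (p.2 : ℂ) * τ) ^ 2
      - 1 / ((p.1 : ℂ) + (p.2 : ℂ) * τ) ^ 2) (wp τ z) := by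
  have hind : LinearIndependent ℝ ![(1 : ℂ), τ] := by
    rw [LinearIndependent.pair_iff]
    intro s t h
    have him := congrArg Complex.im h
    have hre := congrArg Complex.re h
    simp at him hre
    have ht : t = 0 := him.resolve_right hτ.ne'
    simpa [ht] using hre
  let L : PeriodPair := ⟨1, τ, hind⟩
  have hL := (((Equiv.neg L.lattice).hasSum_iff).2 (L.hasSum_weierstrassP z))
  have hL' := (L.latticeEquivProd.symm.toEquiv.hasSum_iff).2 hL
  have hsum : Summable (fun p : ℤ × ℤ ↦ 1 / (z + (p.1 : ℂ) + (p.2 : ℂ) * τ) ^ 2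
      - 1 / ((p.1 : ℂ) + (p.2 : ℂ) * τ) ^ 2) := by
    refine hL'.summable.congr fun p ↦ ?_
    have hp : ((L.latticeEquivProd.symm p : L.lattice) : ℂ) = p.1 + p.2 * τ := by
      rw [L.latticeEquiv_symm_apply]; simp [L]
    have h₁ : z - -((p.1 : ℂ) + p.2 * τ) = z + p.1 + p.2 * τ := by ring
    simp only [Function.comp_apply, LinearEquiv.coe_toEquiv, Equiv.neg_apply, Submodule.coe_neg,
      hp, h₁, neg_sq]
  have hsplit := hsum.hasSum
  rw [hsum.tsum_eq_add_tsum_ite 0] at hsplit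
  simpa [wp] using hsplit

lemma hasSum_wpTilde {τ : ℂ} (hτ : 0 < τ.im) (z : ℂ) :
    HasSum (fun p : ℤ × ℤ ↦ 1 / (z + (1 + τ) / 2 + (p.1 : ℂ) + (p.2 : ℂ) * τ) ^ 2
      - 1 / ((1 + τ) / 2 + (p.1 : ℂ) + (p.2 : ℂ) * τ) ^ 2) (wpTilde τ z) := by
  convert! (hasSum_wp hτ (z + (1 + τ) / 2)).sub (hasSum_wp hτ ((1 + τ) / 2)) using 1
  funext p
  ring

lemma summable_one_div_add_int_sq (w : ℂ) : Summable (fun n : ℤ ↦ 1 / (w + n) ^ 2) :=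
  (EisensteinSeries.linear_right_summable w 1 (k := 2) le_rfl).congr fun n ↦ by simp

/-- Lipschitz's formula for `∑ 1 / (w + n) ^ 2` in the upper half-plane. -/
lemma tsum_one_div_add_int_sq {w : ℂ} (hw : 0 < w.im) :
    ∑' n : ℤ, 1 / (w + n) ^ 2 =
      -(4 * (π : ℂ) ^ 2) * ∑' k : ℕ, (k : ℂ) * cexp (2 * π * I * w) ^ k := by
  have h := EisensteinSeries.qExpansion_identity (k := 1) le_rfl ⟨w, hw⟩
  have hc : (2 * (π : ℂ) * I) ^ 2 = -(4 * (π : ℂ) ^ 2) := by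
    linear_combination (4 * (π : ℂ) ^ 2) * I_sq
  simpa [hc] using h

/-- The row sums `∑ 1 / (w + n) ^ 2` are even and `1`-periodic in `w`. -/
lemma tsum_one_div_add_int_sq_neg_add_one (w : ℂ) :
    ∑' n : ℤ, 1 / (-w + 1 + n) ^ 2 = ∑' n : ℤ, 1 / (w + n) ^ 2 := by
  rw [← (Equiv.subLeft (-1 : ℤ)).tsum_eq]
  refine tsum_congr fun n ↦ ?_
  congr 1
  simp only [Equiv.subLeft_apply]
  push_cast
  ring

/-- The Lambert-type series `∑ k u ^ k / (1 - Q ^ k)` as an iterated sum. -/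
lemma hasSum_lambert {u Q : ℂ} (hu : ‖u‖ < 1) (hQ : ‖Q‖ < 1) :
    HasSum (fun n : ℕ ↦ ∑' k : ℕ, (k : ℂ) * (u * Q ^ n) ^ k)
      (∑' k : ℕ, (k : ℂ) * u ^ k / (1 - Q ^ k)) ∧
    Summable (fun k : ℕ ↦ (k : ℂ) * u ^ k / (1 - Q ^ k)) := by
  have hs : Summable (fun x : ℕ × ℕ ↦ (x.1 : ℂ) * u ^ x.1 * (Q ^ x.1) ^ x.2) := by
    rw [← summable_norm_iff, summable_prod_of_nonneg (fun _ ↦ norm_nonneg _)]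
    have hgeom (k : ℕ) : HasSum (fun n : ℕ ↦ ‖(k : ℂ) * u ^ k * (Q ^ k) ^ n‖)
        (k * ‖u‖ ^ k * (1 - ‖Q‖ ^ k)⁻¹) := by
      rcases Nat.eq_zero_or_pos k with rfl | hk
      · simp
      · have := (hasSum_geometric_of_lt_one (pow_nonneg (norm_nonneg Q) k)
          (pow_lt_one₀ (norm_nonneg Q) hQ hk.ne')).mul_left ((k : ℝ) * ‖u‖ ^ k)
        simpa using this
    refine ⟨fun k ↦ (hgeom k).summable, ?_⟩
    simp_rw [fun k ↦ (hgeom k).tsum_eq]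
    have hb : Summable (fun k : ℕ ↦ (k : ℝ) * ‖u‖ ^ k * (1 - ‖Q‖)⁻¹) := by
      have := summable_pow_mul_geometric_of_norm_lt_one 1 (r := ‖u‖) (by simpa using hu)
      simpa using this.mul_right _
    refine hb.of_nonneg_of_le (fun k ↦ ?_) fun k ↦ ?_
    · have : ‖Q‖ ^ k ≤ 1 := pow_le_one₀ (norm_nonneg _) hQ.le
      have : 0 ≤ 1 - ‖Q‖ ^ k := by linarith
      positivity
    · rcases Nat.eq_zero_or_pos k with rfl | hk
      · simp
      · have : ‖Q‖ ^ k ≤ ‖Q‖ := pow_le_of_le_one (norm_nonneg _) hQ.le hk.ne'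
        have : 0 < 1 - ‖Q‖ := by linarith
        gcongr
  have hfib (k : ℕ) : HasSum (fun n : ℕ ↦ (k : ℂ) * u ^ k * (Q ^ k) ^ n)
      ((k : ℂ) * u ^ k / (1 - Q ^ k)) := by
    rcases Nat.eq_zero_or_pos k with rfl | hk
    · simp
    · have hlt : ‖Q ^ k‖ < 1 := by
        rw [norm_pow]; exact pow_lt_one₀ (norm_nonneg Q) hQ hk.ne'
      simpa [div_eq_mul_inv] using
        (hasSum_geometric_of_norm_lt_one hlt).mul_left ((k : ℂ) * u ^ k)
  have hk := hs.hasSum.prod_fiberwise hfib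
  refine ⟨?_, hk.summable⟩
  rw [hk.tsum_eq]
  have hswap := ((Equiv.prodComm ℕ ℕ).hasSum_iff).2 hs.hasSum
  refine HasSum.prod_fiberwise hswap fun n ↦ ?_
  have hcol : HasSum (fun k : ℕ ↦ (k : ℂ) * u ^ k * (Q ^ k) ^ n)
      (∑' k : ℕ, (k : ℂ) * u ^ k * (Q ^ k) ^ n) :=
    (hs.comp_injective (i := fun k : ℕ ↦ (k, n)) fun a b h ↦ (Prod.ext_iff.1 h).1).hasSum
  convert! hcol using 1
  exact tsum_congr fun k ↦ by rw [mul_pow, pow_right_comm, mul_assoc]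

/-- Summing the rows of the lattice lying above the strip `|Im s| < Im τ / 2`. -/
lemma hasSum_tsum_rows {τ s : ℂ} (hs : |s.im| < τ.im / 2) :
    HasSum (fun m : ℕ ↦ ∑' n : ℤ, 1 / (s + (1 + τ) / 2 + m * τ + n) ^ 2)
      (-(4 * (π : ℂ) ^ 2) * ∑' k : ℕ, (k : ℂ) * (-cexp (π * I * τ) * cexp (2 * π * I * s)) ^ k /
        (1 - (cexp (π * I * τ) ^ 2) ^ k)) ∧
    Summable (fun k : ℕ ↦ (k : ℂ) * (-cexp (π * I * τ) * cexp (2 * π * I * s)) ^ k /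
        (1 - (cexp (π * I * τ) ^ 2) ^ k)) := by
  have hτ : 0 < τ.im := by linarith [abs_nonneg s.im]
  have hs' := (abs_lt.1 hs).1
  set q := cexp (π * I * τ) with hq
  have hexp (w : ℂ) (hw : 0 < w.im) : ‖cexp (2 * π * I * w)‖ < 1 :=
    UpperHalfPlane.norm_exp_two_pi_I_lt_one ⟨w, hw⟩
  have hQ : cexp (2 * π * I * τ) = q ^ 2 := by
    rw [hq, ← Complex.exp_nat_mul]; congr 1; push_cast; ring
  have hrow (m : ℕ) : cexp (2 * π * I * (s + (1 + τ) / 2 + m * τ)) =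
      -q * cexp (2 * π * I * s) * (q ^ 2) ^ m := by
    rw [← hQ, ← Complex.exp_nat_mul, hq, ← neg_one_mul, ← Complex.exp_pi_mul_I,
      ← Complex.exp_add, ← Complex.exp_add, ← Complex.exp_add]
    congr 1; ring
  have him (m : ℕ) : 0 < (s + (1 + τ) / 2 + m * τ).im := by
    have : (0 : ℝ) ≤ m * τ.im := by positivity
    simp
    linarith
  have hu : ‖-q * cexp (2 * π * I * s)‖ < 1 := by
    have h := hexp _ (him 0)
    rw [hrow 0] at h
    simpa using h
  obtain ⟨h₁, h₂⟩ := hasSum_lambert hu (hQ ▸ hexp τ hτ : ‖q ^ 2‖ < 1)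
  refine ⟨?_, h₂⟩
  convert! h₁.mul_left (-(4 * (π : ℂ) ^ 2)) using 1
  funext m
  rw [tsum_one_div_add_int_sq (him m), hrow]

/-- The Fourier expansion of `℘̃` in the strip `|Im z| < Im τ / 2`. -/
lemma hasSum_fourier_wpTilde {τ z : ℂ} (hz : |z.im| < τ.im / 2) :
    HasSum (fun k : ℕ ↦ -(4 * (π : ℂ) ^ 2) * ((k : ℂ) * (-cexp (π * I * τ)) ^ k /
      (1 - (cexp (π * I * τ) ^ 2) ^ k) *
        (cexp (2 * π * I * z) ^ k + (cexp (2 * π * I * z))⁻¹ ^ k - 2))) (wpTilde τ z) := by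
  have hτ : 0 < τ.im := by linarith [abs_nonneg z.im]
  have hswap := ((Equiv.prodComm ℤ ℤ).hasSum_iff).2 (hasSum_wpTilde hτ z)
  have hrows : HasSum (fun m : ℤ ↦ (∑' n : ℤ, 1 / (z + (1 + τ) / 2 + m * τ + n) ^ 2)
      - ∑' n : ℤ, 1 / (0 + (1 + τ) / 2 + m * τ + n) ^ 2) (wpTilde τ z) := by
    refine HasSum.prod_fiberwise hswap fun m ↦ ?_
    convert! (summable_one_div_add_int_sq (z + (1 + τ) / 2 + m * τ)).hasSum.sub
      (summable_one_div_add_int_sq (0 + (1 + τ) / 2 + m * τ)).hasSum using 1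
    funext n
    simp only [Function.comp_apply, Equiv.prodComm_apply, Prod.swap]
    ring
  have hfold := hrows.nat_add_neg_add_one
  have hbelow (s : ℂ) (m : ℕ) :
      ∑' n : ℤ, 1 / (s + (1 + τ) / 2 + (-((m : ℤ) + 1) : ℤ) * τ + n) ^ 2 =
        ∑' n : ℤ, 1 / (-s + (1 + τ) / 2 + m * τ + n) ^ 2 := by
    rw [← tsum_one_div_add_int_sq_neg_add_one]
    refine tsum_congr fun n ↦ ?_
    congr 2
    push_cast
    ring
  simp only [hbelow, Int.cast_natCast, neg_zero] at hfold
  obtain ⟨h₁, g₁⟩ := hasSum_tsum_rows hz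
  obtain ⟨h₂, g₂⟩ := hasSum_tsum_rows (τ := τ) (s := -z) (by simpa using hz)
  obtain ⟨h₃, g₃⟩ := hasSum_tsum_rows (τ := τ) (s := 0) (by simpa using hτ)
  rw [hfold.unique ((h₁.sub h₃).add (h₂.sub h₃))]
  have hneg : cexp (2 * π * I * (-z)) = (cexp (2 * π * I * z))⁻¹ := by
    rw [← Complex.exp_neg]; congr 1; ring
  rw [← mul_sub, ← mul_sub, ← mul_add]
  convert! ((g₁.hasSum.sub g₃.hasSum).add (g₂.hasSum.sub g₃.hasSum)).mul_left
    (-(4 * (π : ℂ) ^ 2)) using 1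
  funext k
  simp only [hneg, mul_zero, Complex.exp_zero, mul_one, mul_pow]
  ring

/-- Telescoping over `ℤ` with step `m`. -/
lemma hasSum_int_sub_shift {T : ℤ → ℂ} {a b : ℂ}
    (hT : Summable fun n : ℤ ↦ T n - T (n - 1))
    (ha : Filter.Tendsto T Filter.atTop (nhds a)) (hb : Filter.Tendsto T Filter.atBot (nhds b))
    (m : ℤ) : HasSum (fun n : ℤ ↦ T n - T (n - m)) (m * (a - b)) := by
  have hstep : HasSum (fun n : ℤ ↦ T n - T (n - 1)) (a - b) := by
    have h := hT.hasSum.nat_add_neg_add_one.tendsto_sum_nat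
    have hpartial (N : ℕ) : ∑ n ∈ Finset.range N, ((T n - T ((n : ℤ) - 1)) +
        (T (-((n : ℤ) + 1)) - T (-((n : ℤ) + 1) - 1))) = T ((N : ℤ) - 1) - T (-(N : ℤ) - 1) := by
      induction N with
      | zero => simp
      | succ N ih =>
        rw [Finset.sum_range_succ, ih]
        push_cast
        rw [show -((N : ℤ) + 1) = -N - 1 by ring, show (N : ℤ) + 1 - 1 = N by ring]
        ring
    have hcast : Filter.Tendsto (fun N : ℕ ↦ (N : ℤ)) Filter.atTop Filter.atTop :=
      tendsto_natCast_atTop_atTop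
    have hlim := (ha.comp (Filter.tendsto_atTop_add_const_right _ (-1) hcast)).sub
      (hb.comp (Filter.tendsto_atBot_add_const_right _ (-1)
        (Filter.tendsto_neg_atTop_atBot.comp hcast)))
    have huniq := tendsto_nhds_unique (h.congr hpartial) hlim
    exact huniq ▸ hT.hasSum
  have hshift (k : ℤ) : HasSum (fun n : ℤ ↦ T (n - k) - T (n - k - 1)) (a - b) :=
    ((Equiv.subRight k).hasSum_iff).2 hstep
  induction m using Int.induction_on with
  | zero => simp
  | succ i ih =>
    convert! ih.add (hshift i) using 1
    · funext n
      rw [sub_sub n]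
      ring
    · push_cast; ring
  | pred i ih =>
    convert! ih.sub (hshift (-i - 1)) using 1
    · funext n
      rw [show n - (-(i : ℤ) - 1) - 1 = n - -i by ring]
      ring
    · push_cast; ring

/-- `1 / cos ((n + 1/2) π τ)` in terms of `p = exp (π i τ / 2)`. -/
noncomputable def secCoeff (p : ℂ) (n : ℤ) : ℂ := 2 * p ^ (2 * n + 1) / (1 + (p ^ (2 * n + 1)) ^ 2)

lemma one_add_zpow_sq_ne_zero {p : ℂ} (hp : ‖p‖ < 1) {j : ℤ} (hj : j ≠ 0) :
    1 + (p ^ j) ^ 2 ≠ 0 := by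
  intro h
  have h1 : (p ^ j) ^ 2 = -1 := by linear_combination h
  have h2 : ‖p‖ ^ (j * 2) = 1 := by
    rw [zpow_mul, ← norm_zpow]
    simpa using congrArg norm h1
  rw [zpow_eq_one_iff_right₀ (norm_nonneg p) hp.ne] at h2
  omega

lemma secCoeff_neg {p : ℂ} (hp0 : p ≠ 0) (n : ℤ) : secCoeff p (-(n + 1)) = secCoeff p n := by
  have h : 2 * -(n + 1) + 1 = -(2 * n + 1) := by ring
  have h0 : p ^ (2 * n + 1) ≠ 0 := zpow_ne_zero _ hp0
  rw [secCoeff, secCoeff, h, zpow_neg]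
  generalize p ^ (2 * n + 1) = P at *
  rw [show 1 + P⁻¹ ^ 2 = (1 + P ^ 2) / P ^ 2 by field_simp; ring]
  rw [div_div_eq_mul_div]
  congr 1
  field_simp

lemma norm_secCoeff_le {p : ℂ} (hp : ‖p‖ < 1) (n : ℕ) :
    ‖secCoeff p n‖ ≤ 2 / (1 - ‖p‖) * ‖p‖ ^ (2 * n + 1) := by
  have hz : p ^ (2 * (n : ℤ) + 1) = p ^ (2 * n + 1) := by exact_mod_cast zpow_natCast p (2 * n + 1)
  rw [secCoeff, hz, norm_div, norm_mul, norm_pow]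
  have h1 : 1 - ‖p‖ ≤ ‖1 + (p ^ (2 * n + 1)) ^ 2‖ := by
    have h2 : ‖(p ^ (2 * n + 1)) ^ 2‖ ≤ ‖p‖ := by
      rw [← pow_mul, norm_pow]
      exact pow_le_of_le_one (norm_nonneg _) hp.le (by omega)
    have h3 := norm_sub_norm_le (1 : ℂ) (-(p ^ (2 * n + 1)) ^ 2)
    rw [sub_neg_eq_add, norm_neg, norm_one] at h3
    linarith
  have h4 : 0 < 1 - ‖p‖ := by linarith
  rw [div_mul_eq_mul_div, Complex.norm_ofNat]
  gcongr

/-- The terms of the bilateral exponential series of `4 i SD`. -/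
noncomputable def sdTerm (p t : ℂ) (n : ℤ) : ℂ := (-1) ^ n * t ^ (2 * n + 1) * secCoeff p n

lemma sdTerm_neg {p : ℂ} (hp0 : p ≠ 0) (t : ℂ) (n : ℤ) :
    sdTerm p t (-(n + 1)) = -sdTerm p t⁻¹ n := by
  rw [sdTerm, sdTerm, secCoeff_neg hp0, show 2 * -(n + 1) + 1 = -(2 * n + 1) by ring, inv_zpow',
    zpow_neg (-1 : ℂ), ← inv_zpow, inv_neg, inv_one, zpow_add₀ (by simp), zpow_one]
  ring

lemma summable_norm_sdTerm_nat {p t : ℂ} (hp : ‖p‖ < 1) (ht : ‖p‖ * ‖t‖ < 1) :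
    Summable fun n : ℕ ↦ ‖sdTerm p t n‖ := by
  have hgeom : Summable fun n : ℕ ↦ 2 / (1 - ‖p‖) * (‖p‖ * ‖t‖) * ((‖p‖ * ‖t‖) ^ 2) ^ n :=
    (summable_geometric_of_lt_one (by positivity)
      (pow_lt_one₀ (by positivity) ht two_ne_zero)).mul_left _
  refine hgeom.of_nonneg_of_le (fun _ ↦ norm_nonneg _) fun n ↦ ?_
  have hz : t ^ (2 * (n : ℤ) + 1) = t ^ (2 * n + 1) := by exact_mod_cast zpow_natCast t (2 * n + 1)
  rw [sdTerm, hz, norm_mul, norm_mul, norm_zpow, norm_neg, norm_one, one_zpow, one_mul, norm_pow]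
  calc ‖t‖ ^ (2 * n + 1) * ‖secCoeff p n‖
      ≤ ‖t‖ ^ (2 * n + 1) * (2 / (1 - ‖p‖) * ‖p‖ ^ (2 * n + 1)) := by
        gcongr; exact norm_secCoeff_le hp n
    _ = _ := by ring

lemma summable_norm_sdTerm {p t : ℂ} (hp0 : p ≠ 0) (hp : ‖p‖ < 1) (ht : ‖p‖ * ‖t‖ < 1)
    (ht' : ‖p‖ * ‖t⁻¹‖ < 1) : Summable fun n : ℤ ↦ ‖sdTerm p t n‖ := by
  refine Summable.of_nat_of_neg_add_one (summable_norm_sdTerm_nat hp ht) ?_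
  simpa only [sdTerm_neg hp0, norm_neg] using summable_norm_sdTerm_nat hp ht'

lemma sdTerm_mul_sdTerm (p : ℂ) {t : ℂ} (ht : t ≠ 0) (m n : ℤ) :
    sdTerm p t n * sdTerm p t (m - 1 - n) =
      -(-1) ^ m * (t ^ 2) ^ m * (secCoeff p n * secCoeff p (m - 1 - n)) := by
  have h1 : (-1 : ℂ) ^ n * (-1) ^ (m - 1 - n) = -(-1) ^ m := by
    rw [← zpow_add₀ (by simp), show n + (m - 1 - n) = m - 1 by ring, zpow_sub₀ (by simp), zpow_one,
      div_neg, div_one]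
  have h2 : t ^ (2 * n + 1) * t ^ (2 * (m - 1 - n) + 1) = (t ^ 2) ^ m := by
    rw [← zpow_add₀ ht, ← zpow_natCast t 2, ← zpow_mul]
    congr 1
    push_cast
    ring
  rw [sdTerm, sdTerm, ← h1, ← h2]
  ring

/-- The addition formula behind the telescoping of `∑ sec x sec y` with `x + y` fixed. -/
lemma secCoeff_mul_secCoeff {p : ℂ} (hp0 : p ≠ 0) (hp : ‖p‖ < 1) {m : ℤ} (hm : m ≠ 0) (n : ℤ) :
    secCoeff p n * secCoeff p (m - 1 - n) = 4 * (p ^ 2) ^ m / (1 - ((p ^ 2) ^ 2) ^ m) *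
      (1 / (1 + (p ^ (2 * n + 1)) ^ 2) - 1 / (1 + (p ^ (2 * (n - m) + 1)) ^ 2)) := by
  have hA : 1 + (p ^ (2 * n + 1)) ^ 2 ≠ 0 := one_add_zpow_sq_ne_zero hp (by omega)
  have hB : 1 + (p ^ (2 * (n - m) + 1)) ^ 2 ≠ 0 :=
    one_add_zpow_sq_ne_zero hp (by omega)
  have hC : 1 + (p ^ (2 * (m - 1 - n) + 1)) ^ 2 ≠ 0 :=
    one_add_zpow_sq_ne_zero hp (by omega)
  have hM : (1 : ℂ) - ((p ^ 2) ^ 2) ^ m ≠ 0 := by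
    intro h
    have h1 : ‖p‖ ^ (4 * m) = 1 := by
      rw [zpow_mul]
      have := congrArg norm (sub_eq_zero.1 h).symm
      rw [norm_zpow, norm_one, norm_pow, norm_pow, ← pow_mul] at this
      exact_mod_cast this
    rw [zpow_eq_one_iff_right₀ (norm_nonneg p) hp.ne] at h1
    omega
  have hP0 : p ^ (2 * n + 1) ≠ 0 := zpow_ne_zero _ hp0
  have hR0 : (p ^ 2) ^ m ≠ 0 := zpow_ne_zero _ (pow_ne_zero _ hp0)
  have hR : p ^ (2 * m) = (p ^ 2) ^ m := by rw [zpow_mul]; norm_cast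
  have e1 : p ^ (2 * (n - m) + 1) = p ^ (2 * n + 1) / (p ^ 2) ^ m := by
    rw [← hR, ← zpow_sub₀ hp0]; congr 1; ring
  have e2 : p ^ (2 * (m - 1 - n) + 1) = (p ^ 2) ^ m / p ^ (2 * n + 1) := by
    rw [← hR, ← zpow_sub₀ hp0]; congr 1; ring
  have e3 : ((p ^ 2) ^ 2) ^ m = ((p ^ 2) ^ m) ^ 2 := by
    rw [pow_two (p ^ 2), mul_zpow, ← pow_two ((p ^ 2) ^ m)]
  rw [secCoeff, secCoeff]
  rw [e1] at hB ⊢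
  rw [e2] at hC ⊢
  rw [e3] at hM ⊢
  clear e1 e2 e3 hR
  generalize p ^ (2 * n + 1) = P at *
  generalize (p ^ 2) ^ m = R at *
  have hB' : R ^ 2 + P ^ 2 ≠ 0 := by
    intro h; apply hB; field_simp; linear_combination h
  have hC' : P ^ 2 + R ^ 2 ≠ 0 := by rwa [add_comm]
  field_simp
  ring

lemma hasSum_secCoeff_mul_secCoeff {p : ℂ} (hp0 : p ≠ 0) (hp : ‖p‖ < 1) {m : ℤ} (hm : m ≠ 0) :
    HasSum (fun n : ℤ ↦ secCoeff p n * secCoeff p (m - 1 - n))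
      (4 * (p ^ 2) ^ m / (1 - ((p ^ 2) ^ 2) ^ m) * m) := by
  let T : ℤ → ℂ := fun n ↦ 1 / (1 + (p ^ (2 * n + 1)) ^ 2)
  have htop : Filter.Tendsto T Filter.atTop (nhds 1) := by
    rw [← Nat.map_cast_int_atTop, Filter.tendsto_map'_iff]
    have hodd : Filter.Tendsto (fun n : ℕ ↦ 2 * n + 1) Filter.atTop Filter.atTop :=
      Filter.tendsto_atTop_mono (fun n ↦ by dsimp; omega) Filter.tendsto_id
    have hpow := (tendsto_pow_atTop_nhds_zero_of_norm_lt_one hp).comp hodd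
    have hlim := ((hpow.pow 2).const_add 1).inv₀ (by simp)
    simp only [ne_eq, OfNat.ofNat_ne_zero, not_false_eq_true, zero_pow, add_zero, inv_one] at hlim
    refine hlim.congr fun n ↦ ?_
    simp only [T, Function.comp_apply, one_div]
    norm_cast
  have hrefl (n : ℤ) : 1 - T (-1 - n) = T n := by
    have hA : 1 + (p ^ (2 * n + 1)) ^ 2 ≠ 0 := one_add_zpow_sq_ne_zero hp (by omega)
    have hP0 : p ^ (2 * n + 1) ≠ 0 := zpow_ne_zero _ hp0
    simp only [T]
    rw [show 2 * (-1 - n) + 1 = -(2 * n + 1) by ring, zpow_neg]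
    generalize p ^ (2 * n + 1) = P at *
    have hA' : P ^ 2 + 1 ≠ 0 := by rwa [add_comm]
    field_simp
    ring
  have hbot : Filter.Tendsto T Filter.atBot (nhds 0) := by
    have h := (htop.comp (Filter.tendsto_atTop_add_const_left _ (-1)
      Filter.tendsto_neg_atBot_atTop)).const_sub 1
    rw [sub_self] at h
    exact h.congr hrefl
  have hprod : Summable fun x : ℤ × ℤ ↦ sdTerm p 1 x.1 * sdTerm p 1 x.2 := by
    have h := summable_norm_sdTerm hp0 hp (t := 1) (by simpa using hp) (by simpa using hp)
    exact summable_mul_of_summable_norm h h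
  have hT : Summable fun n : ℤ ↦ T n - T (n - 1) := by
    have h := hprod.comp_injective (i := fun n : ℤ ↦ (n, 1 - 1 - n))
      fun a b hab ↦ (Prod.ext_iff.1 hab).1
    have hc : 4 * (p ^ 2) ^ (1 : ℤ) / (1 - ((p ^ 2) ^ 2) ^ (1 : ℤ)) ≠ 0 := by
      have hlt : ‖(p ^ 2) ^ 2‖ < 1 := by
        rw [← pow_mul, norm_pow]
        exact pow_lt_one₀ (norm_nonneg _) hp (by norm_num)
      have hne : 1 - (p ^ 2) ^ 2 ≠ 0 := by
        intro h0
        rw [← sub_eq_zero.1 h0, norm_one] at hlt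
        exact lt_irrefl _ hlt
      rw [zpow_one, zpow_one]
      exact div_ne_zero (mul_ne_zero (by norm_num) (pow_ne_zero _ hp0)) hne
    rw [← summable_mul_left_iff hc]
    refine h.congr fun n ↦ ?_
    rw [Function.comp_apply, sdTerm_mul_sdTerm p one_ne_zero,
      secCoeff_mul_secCoeff hp0 hp one_ne_zero]
    simp [T]
  have h := (hasSum_int_sub_shift hT htop hbot m).mul_left
    (4 * (p ^ 2) ^ m / (1 - ((p ^ 2) ^ 2) ^ m))
  rw [sub_zero, mul_one] at h
  simpa only [secCoeff_mul_secCoeff hp0 hp hm] using h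

/-- The Fourier expansion of the square of the bilateral series. -/
lemma hasSum_sq_tsum_sdTerm {p t : ℂ} (hp0 : p ≠ 0) (hp : ‖p‖ < 1) (ht0 : t ≠ 0)
    (ht : ‖p‖ * ‖t‖ < 1) (ht' : ‖p‖ * ‖t⁻¹‖ < 1) :
    HasSum (fun m : ℤ ↦ -(-1) ^ m * (t ^ 2) ^ m * ∑' n : ℤ, secCoeff p n * secCoeff p (m - 1 - n))
      ((∑' n : ℤ, sdTerm p t n) ^ 2) := by
  have hn := summable_norm_sdTerm hp0 hp ht ht'
  have hprod := summable_mul_of_summable_norm hn hn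
  have hmul := hn.of_norm.hasSum.mul hn.of_norm.hasSum hprod
  rw [← pow_two] at hmul
  let e : ℤ × ℤ ≃ ℤ × ℤ :=
    { toFun := fun x ↦ (x.2, x.1 - 1 - x.2)
      invFun := fun y ↦ (y.1 + y.2 + 1, y.1)
      left_inv := fun x ↦ Prod.ext (by simp) (by simp)
      right_inv := fun y ↦ Prod.ext (by simp) (by simp) }
  have he := (e.hasSum_iff).2 hmul
  refine HasSum.prod_fiberwise he fun m ↦ ?_
  have hfib := (he.summable.prod_factor m).hasSum
  convert! hfib using 1
  rw [← tsum_mul_left]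
  exact tsum_congr fun n ↦ (sdTerm_mul_sdTerm p ht0 m n).symm

lemma tsum_sdTerm_one {p : ℂ} (hp0 : p ≠ 0) (hp : ‖p‖ < 1) : ∑' n : ℤ, sdTerm p 1 n = 0 := by
  have h := summable_norm_sdTerm hp0 hp (t := 1) (by simpa using hp) (by simpa using hp)
  rw [← tsum_nat_add_neg_add_one h.of_norm]
  simp only [sdTerm_neg hp0, inv_one, add_neg_cancel, tsum_zero]

lemma hasSum_sq_tsum_sdTerm_nat {p t : ℂ} (hp0 : p ≠ 0) (hp : ‖p‖ < 1) (ht0 : t ≠ 0)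
    (ht : ‖p‖ * ‖t‖ < 1) (ht' : ‖p‖ * ‖t⁻¹‖ < 1) :
    HasSum (fun k : ℕ ↦ -4 * ((k : ℂ) * (-p ^ 2) ^ k / (1 - ((p ^ 2) ^ 2) ^ k) *
      ((t ^ 2) ^ k + (t ^ 2)⁻¹ ^ k - 2))) ((∑' n : ℤ, sdTerm p t n) ^ 2) := by
  have h := (hasSum_sq_tsum_sdTerm hp0 hp ht0 ht ht').sub
    (hasSum_sq_tsum_sdTerm hp0 hp one_ne_zero (by simpa using hp) (by simpa using hp))
  rw [tsum_sdTerm_one hp0 hp] at h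
  have hfold := h.nat_add_neg
  simp only [zpow_zero, one_pow, one_zpow, sub_self, add_zero, ne_eq, OfNat.ofNat_ne_zero,
    not_false_eq_true, zero_pow, sub_zero, mul_one] at hfold
  convert! hfold using 1
  funext k
  rcases Nat.eq_zero_or_pos k with rfl | hk
  · simp
  have hk0 : (k : ℤ) ≠ 0 := by omega
  have hM : 1 - ((p ^ 2) ^ 2) ^ k ≠ 0 := by
    intro h0
    have hlt : ‖((p ^ 2) ^ 2) ^ k‖ < 1 := by
      rw [← pow_mul, ← pow_mul, norm_pow]
      exact pow_lt_one₀ (norm_nonneg _) hp (by omega)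
    rw [← sub_eq_zero.1 h0, norm_one] at hlt
    exact lt_irrefl _ hlt
  rw [(hasSum_secCoeff_mul_secCoeff hp0 hp hk0).tsum_eq,
    (hasSum_secCoeff_mul_secCoeff hp0 hp (neg_ne_zero.2 hk0)).tsum_eq]
  simp only [zpow_neg, zpow_natCast, Int.cast_neg, Int.cast_natCast, neg_pow (p ^ 2), inv_pow]
  have hq0 : (p ^ 2) ^ k ≠ 0 := pow_ne_zero _ (pow_ne_zero _ hp0)
  have hs : ((-1 : ℂ) ^ k)⁻¹ = (-1) ^ k := by rw [← inv_pow, inv_neg, inv_one]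
  have he : ((p ^ 2) ^ 2) ^ k = ((p ^ 2) ^ k) ^ 2 := pow_right_comm _ _ _
  rw [hs]
  rw [he] at hM ⊢
  generalize (p ^ 2) ^ k = R at *
  generalize (t ^ 2) ^ k = S at *
  have hinv : 4 * R⁻¹ / (1 - (R ^ 2)⁻¹) * -(k : ℂ) = 4 * R / (1 - R ^ 2) * k := by
    have h1 : 1 - (R ^ 2)⁻¹ = -(1 - R ^ 2) / R ^ 2 := by field_simp; ring
    rw [h1]
    field_simp
  rw [hinv]
  ring

lemma secCoeff_eq_one_div_cos (τ : ℂ) (n : ℕ) :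
    secCoeff (cexp (π * I * τ / 2)) n = 1 / Complex.cos (((n : ℂ) + 1/2) * (π : ℂ) * τ) := by
  have hP : cexp (π * I * τ / 2) ^ (2 * (n : ℤ) + 1) =
      cexp (((n : ℂ) + 1/2) * (π : ℂ) * τ * I) := by
    rw [← Complex.exp_int_mul]; congr 1; push_cast; ring
  rw [secCoeff, hP, Complex.cos, neg_mul, Complex.exp_neg]
  have h0 := Complex.exp_ne_zero (((n : ℂ) + 1/2) * (π : ℂ) * τ * I)
  generalize cexp (((n : ℂ) + 1/2) * (π : ℂ) * τ * I) = P at *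
  have h1 : P + P⁻¹ = (1 + P ^ 2) / P := by field_simp; ring
  rw [h1, div_div, one_div_div]
  ring

lemma sdTerm_add_sdTerm_neg (τ z : ℂ) (n : ℕ) :
    sdTerm (cexp (π * I * τ / 2)) (cexp (π * I * z)) n +
      sdTerm (cexp (π * I * τ / 2)) (cexp (π * I * z)) (-((n : ℤ) + 1)) =
    2 * I * ((-1 : ℂ) ^ n * Complex.sin ((2 * (n : ℂ) + 1) * (π : ℂ) * z) /
      Complex.cos (((n : ℂ) + 1/2) * (π : ℂ) * τ)) := by
  have ht : cexp (π * I * z) ^ (2 * (n : ℤ) + 1) = cexp ((2 * (n : ℂ) + 1) * (π : ℂ) * z * I) := by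
    rw [← Complex.exp_int_mul]; congr 1; push_cast; ring
  rw [sdTerm_neg (Complex.exp_ne_zero _), sdTerm, sdTerm, inv_zpow, ht, secCoeff_eq_one_div_cos,
    Complex.sin, neg_mul, Complex.exp_neg, zpow_natCast]
  linear_combination (-(-1 : ℂ) ^ n * (cexp ((2 * (n : ℂ) + 1) * (π : ℂ) * z * I))⁻¹ +
    (-1 : ℂ) ^ n * cexp ((2 * (n : ℂ) + 1) * (π : ℂ) * z * I)) /
      Complex.cos (((n : ℂ) + 1/2) * (π : ℂ) * τ) * I_sq

lemma SD_add_one (τ z : ℂ) : SD τ (z + 1) = -SD τ z := by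
  have hsin (n : ℕ) : Complex.sin ((2 * (n : ℂ) + 1) * (π : ℂ) * (z + 1)) =
      -Complex.sin ((2 * (n : ℂ) + 1) * (π : ℂ) * z) := by
    rw [show (2 * (n : ℂ) + 1) * (π : ℂ) * (z + 1) =
      (2 * (n : ℂ) + 1) * (π : ℂ) * z + π + n * (2 * π) by ring,
      Complex.sin_add_nat_mul_two_pi, Complex.sin_add_pi]
  simp only [SD, hsin, mul_neg, neg_div, tsum_neg]

lemma SD_sq_eq {τ z : ℂ} (hz : |z.im| < τ.im / 2) :
    SD τ z ^ 2 = -(1 / (16 * (π : ℂ) ^ 2)) * wpTilde τ z := by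
  set p := cexp (π * I * τ / 2) with hp
  set t := cexp (π * I * z) with ht
  obtain ⟨hz₁, hz₂⟩ := abs_lt.1 hz
  have hnp : ‖p‖ = Real.exp (-(π * τ.im / 2)) := by
    rw [hp, Complex.norm_exp]; congr 1; simp [neg_div]
  have hnt : ‖t‖ = Real.exp (-(π * z.im)) := by
    rw [ht, Complex.norm_exp]; congr 1; simp
  have hp1 : ‖p‖ < 1 := by
    rw [hnp, Real.exp_lt_one_iff]
    nlinarith [Real.pi_pos]
  have hpt : ‖p‖ * ‖t‖ < 1 := by
    rw [hnp, hnt, ← Real.exp_add, Real.exp_lt_one_iff]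
    nlinarith [Real.pi_pos]
  have hpt' : ‖p‖ * ‖t⁻¹‖ < 1 := by
    rw [norm_inv, hnp, hnt, ← Real.exp_neg, ← Real.exp_add, Real.exp_lt_one_iff]
    nlinarith [Real.pi_pos]
  have hp0 : p ≠ 0 := Complex.exp_ne_zero _
  have hD : ∑' n : ℤ, sdTerm p t n = 4 * I * SD τ z := by
    rw [← tsum_nat_add_neg_add_one (summable_norm_sdTerm hp0 hp1 hpt hpt').of_norm]
    simp only [hp, ht, sdTerm_add_sdTerm_neg, tsum_mul_left, SD]
    ring
  have hsd := hasSum_sq_tsum_sdTerm_nat hp0 hp1 (Complex.exp_ne_zero _) hpt hpt'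
  have hwp := hasSum_fourier_wpTilde hz
  have hp2 : p ^ 2 = cexp (π * I * τ) := by
    rw [hp, ← Complex.exp_nat_mul]; congr 1; push_cast; ring
  have ht2 : t ^ 2 = cexp (2 * π * I * z) := by
    rw [ht, ← Complex.exp_nat_mul]; congr 1; push_cast; ring
  rw [hD, hp2, ht2] at hsd
  have hpi : (π : ℂ) ≠ 0 := Complex.ofReal_ne_zero.2 Real.pi_ne_zero
  have hscaled := hsd.mul_left ((π : ℂ) ^ 2)
  have heq : (π : ℂ) ^ 2 * (4 * I * SD τ z) ^ 2 = wpTilde τ z := by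
    refine hscaled.unique ?_
    convert! hwp using 1
    funext k
    ring
  rw [← heq]
  field_simp
  linear_combination 16 * SD τ z ^ 2 * I_sq

theorem stmt19 (τ : ℂ) (hτ : 0 < τ.im) (α β : ℝ) (hβ : |β| < 1/2) :
    SD τ ((α : ℂ) + (β : ℂ) * τ + 1) = -SD τ ((α : ℂ) + (β : ℂ) * τ) ∧
    SD τ ((α : ℂ) + (β : ℂ) * τ) ^ 2
      = -(1 / (16 * (π : ℂ) ^ 2)) * wpTilde τ ((α : ℂ) + (β : ℂ) * τ) := by
  refine ⟨SD_add_one _ _, SD_sq_eq ?_⟩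
  have him : ((α : ℂ) + (β : ℂ) * τ).im = β * τ.im := by simp
  rw [him, abs_mul, abs_of_pos hτ]
  nlinarith
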